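/- Let S̃ be a totally bounded subset of (𝕃,𝐡) with metric dimension bounded by 𝐃, and let ε satisfy ε ≥ 1/2 and 𝐃(ε) ≤ (ε/c₀)² with c₀=1000. If S̄ is an ε-net for S̃ satisfying the metric-dimension cardinality bound (|{𝐭∈S̄ : 𝐡(𝐬,𝐭)≤r}| ≤ exp[𝐃(ε)(r/ε)²] for all 𝐬∈𝕃 and r≥2ε) and S = S̄, then ε^{S̄}(𝐬) ≤ 2ε for every 𝐬∈𝕃. -/

import Mathlib

open MeasureTheory Real Filter Set
open scoped Classical ENNReal

noncomputable section

/-- Squared Hellinger distance `h²(p·ν, q·ν) = (1/2)∫(√p−√q)² dν` between two densities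
with respect to the reference measure `ν`. -/
def hellSq {X : Type*} [MeasurableSpace X] (ν : Measure X) (p q : X → ℝ) : ℝ :=
  (1 / 2) * ∫ x, (Real.sqrt (p x) - Real.sqrt (q x)) ^ 2 ∂ν

/-- Hellinger-type distance `𝐡` between `n`-tuples of densities:
`𝐡²(𝐭,𝐭′)=Σᵢ h²(tᵢ·μᵢ, tᵢ′·μᵢ)`. -/
def bH {n : ℕ} {𝒳 : Fin n → Type*} [∀ i, MeasurableSpace (𝒳 i)]
    (μ : ∀ i, Measure (𝒳 i)) (t t' : ∀ i, 𝒳 i → ℝ) : ℝ :=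
  Real.sqrt (∑ i, hellSq (μ i) (t i) (t' i))

/-- `ψ(√(b/a))` where `ψ(x)=(x−1)/(x+1)`, `ψ(+∞)=1`, with the conventions
`a/0 = +∞` for `a>0` and `0/0 = 1`. -/
def psiR (a b : ℝ) : ℝ :=
  if a = 0 then (if b = 0 then 0 else 1)
  else (Real.sqrt (b / a) - 1) / (Real.sqrt (b / a) + 1)

/-- `Ψ(𝐱,𝐭,𝐭′) = Σᵢ ψ(√(tᵢ′(xᵢ)/tᵢ(xᵢ)))`. -/
def Psi {n : ℕ} {𝒳 : Fin n → Type*} (x : ∀ i, 𝒳 i) (t t' : ∀ i, 𝒳 i → ℝ) : ℝ :=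
  ∑ i, psiR (t i (x i)) (t' i (x i))

/-- `t` is an `n`-tuple of probability densities with respect to the `μ i`'s, i.e. an
element of `𝕃 = ∏ᵢ ℒᵢ`. -/
def IsDensityT {n : ℕ} {𝒳 : Fin n → Type*} [∀ i, MeasurableSpace (𝒳 i)]
    (μ : ∀ i, Measure (𝒳 i)) (t : ∀ i, 𝒳 i → ℝ) : Prop :=
  ∀ i, Measurable (t i) ∧ (∀ x, 0 ≤ t i x) ∧
    ∫⁻ x, ENNReal.ofReal (t i x) ∂(μ i) = 1

/-- The law `P_𝐬 = ⊗ᵢ (sᵢ·μᵢ)` of `X=(X₁,…,Xₙ)`. -/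
def Plaw {n : ℕ} {𝒳 : Fin n → Type*} [∀ i, MeasurableSpace (𝒳 i)]
    (μ : ∀ i, Measure (𝒳 i)) (s : ∀ i, 𝒳 i → ℝ) : Measure (∀ i, 𝒳 i) :=
  Measure.pi fun i => (μ i).withDensity fun x => ENNReal.ofReal (s i x)

/-- `𝐰^{S̄}(𝐬,y)`: expectation under `P_𝐬` of the supremum of the centred process
`|Ψ(X,𝐭,𝐭′)−E_𝐬Ψ(X,𝐭,𝐭′)|` over pairs `𝐭,𝐭′` in the Hellinger ball of radius `y`
of the countable set `S`, with the convention that the supremum over ∅ is 1. -/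
def wS {n : ℕ} {𝒳 : Fin n → Type*} [∀ i, MeasurableSpace (𝒳 i)]
    (μ : ∀ i, Measure (𝒳 i)) (s : ∀ i, 𝒳 i → ℝ) (S : Set (∀ i, 𝒳 i → ℝ)) (y : ℝ) : ℝ :=
  if Nonempty {p : (∀ i, 𝒳 i → ℝ) × (∀ i, 𝒳 i → ℝ) //
      p.1 ∈ S ∧ p.2 ∈ S ∧ bH μ s p.1 ≤ y ∧ bH μ s p.2 ≤ y} then
    ∫ x, (⨆ p : {p : (∀ i, 𝒳 i → ℝ) × (∀ i, 𝒳 i → ℝ) //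
        p.1 ∈ S ∧ p.2 ∈ S ∧ bH μ s p.1 ≤ y ∧ bH μ s p.2 ≤ y},
      |Psi x p.1.1 p.1.2 - ∫ x', Psi x' p.1.1 p.1.2 ∂(Plaw μ s)|) ∂(Plaw μ s)
  else 1

/-- `ε^{S̄}(𝐬) = sup{y ≥ 1 : 𝐰^{S̄}(𝐬,y) > 6c₀⁻¹y²}` with `c₀ = 1000`. -/
def epsS {n : ℕ} {𝒳 : Fin n → Type*} [∀ i, MeasurableSpace (𝒳 i)]
    (μ : ∀ i, Measure (𝒳 i)) (s : ∀ i, 𝒳 i → ℝ) (S : Set (∀ i, 𝒳 i → ℝ)) : ℝ :=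
  sSup {y : ℝ | 1 ≤ y ∧ 6 / 1000 * y ^ 2 < wS μ s S y}


/-- `S̃ ⊂ 𝕃` admits a metric dimension bounded by `𝐃 : (0,√n] → [1/2,∞)` for the
Hellinger-type distance `𝐡`: for every `ε ∈ (0,√n]` there is an `ε`-net `N` for `S̃`
such that for every density `𝐬 ∈ 𝕃`, `|{𝐭 ∈ N : 𝐡(𝐬,𝐭) ≤ r}| ≤ exp[𝐃(ε)(r/ε)²]`
for all `r ≥ 2ε`. -/
def DimBoundN {n : ℕ} {𝒳 : Fin n → Type*} [∀ i, MeasurableSpace (𝒳 i)]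
    (μ : ∀ i, Measure (𝒳 i)) (St : Set (∀ i, 𝒳 i → ℝ)) (D : ℝ → ℝ) : Prop :=
  ∀ ε : ℝ, 0 < ε → ε ≤ Real.sqrt n → ∃ N : Set (∀ i, 𝒳 i → ℝ),
    (∀ t ∈ N, IsDensityT μ t) ∧
    (∀ t ∈ St, ∃ u ∈ N, bH μ t u ≤ ε) ∧
    ∀ s : ∀ i, 𝒳 i → ℝ, IsDensityT μ s → ∀ r : ℝ, 2 * ε ≤ r →
      {t ∈ N | bH μ s t ≤ r}.Finite ∧
      ({t ∈ N | bH μ s t ≤ r}.ncard : ℝ) ≤ Real.exp (D ε * (r / ε) ^ 2)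

lemma psiR_eq {a b : ℝ} (ha : 0 ≤ a) (hb : 0 ≤ b) :
    psiR a b = (√b - √a) / (√b + √a) := by
  unfold psiR
  split_ifs with h1 h2
  · simp [h1, h2]
  · have : √b ≠ 0 := (Real.sqrt_pos.2 (lt_of_le_of_ne hb (Ne.symm h2))).ne'
    simp [h1, this]
  · have h3 : 0 < √a := Real.sqrt_pos.2 (lt_of_le_of_ne ha (Ne.symm h1))
    have h4 := Real.sqrt_nonneg b
    rw [Real.sqrt_div hb]
    field_simp

lemma abs_psiR_le {a b : ℝ} (ha : 0 ≤ a) (hb : 0 ≤ b) : |psiR a b| ≤ 1 := by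
  rw [psiR_eq ha hb, abs_div]
  have h3 := Real.sqrt_nonneg a
  have h4 := Real.sqrt_nonneg b
  rw [abs_of_nonneg (add_nonneg h4 h3)]
  apply div_le_one_of_le₀ _ (add_nonneg h4 h3)
  rw [abs_le]
  constructor <;> linarith

lemma psiR_sq_le {s a b : ℝ} (hs : 0 ≤ s) (ha : 0 ≤ a) (hb : 0 ≤ b) :
    s * psiR a b ^ 2 ≤ (√s - √a) ^ 2 + (√s - √b) ^ 2 := by
  rw [psiR_eq ha hb]
  have h3 := Real.sqrt_nonneg a
  have h4 := Real.sqrt_nonneg b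
  have h5 : s = √s ^ 2 := (Real.sq_sqrt hs).symm
  rcases eq_or_lt_of_le (add_nonneg h4 h3) with h | h
  · rw [← h]; simp; positivity
  · rw [div_pow]
    conv_lhs => rw [h5]
    rw [mul_div_assoc', div_le_iff₀ (by positivity)]
    have h6 : 0 ≤ √a * √b * (√s - (√a + √b) / 2) ^ 2 := by positivity
    have h7 : 0 ≤ (√b - √a) ^ 2 * (√s - (√a + √b)) ^ 2 := by positivity
    nlinarith [h6, h7]

lemma measurable_psiR {X : Type*} [MeasurableSpace X] {f g : X → ℝ} (hf : Measurable f)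
    (hg : Measurable g) (hf0 : ∀ x, 0 ≤ f x) (hg0 : ∀ x, 0 ≤ g x) :
    Measurable fun x => psiR (f x) (g x) := by
  have : (fun x => psiR (f x) (g x)) = fun x => (√(g x) - √(f x)) / (√(g x) + √(f x)) := by
    ext x; exact psiR_eq (hf0 x) (hg0 x)
  rw [this]
  fun_prop

lemma exp_quad {u : ℝ} (hu : |u| ≤ 1) : Real.exp u ≤ 1 + u + 3 / 4 * u ^ 2 := by
  have h := Real.exp_bound hu (n := 3) (by norm_num)
  simp only [Finset.sum_range_succ, Finset.sum_range_zero, Nat.factorial] at h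
  norm_num at h
  have h1 := (abs_le.1 h).2
  have h2 : |u| ^ 3 ≤ u ^ 2 := by
    rw [← sq_abs u]
    exact pow_le_pow_of_le_one (abs_nonneg u) hu (by norm_num)
  nlinarith [sq_nonneg u]

lemma integrable_dens {X : Type*} [MeasurableSpace X] {ν : Measure X} {p : X → ℝ}
    (hp : Measurable p) (hp0 : ∀ x, 0 ≤ p x) (h1 : ∫⁻ x, ENNReal.ofReal (p x) ∂ν = 1) :
    Integrable p ν := by
  refine ⟨hp.aestronglyMeasurable, ?_⟩
  rw [hasFiniteIntegral_iff_ofReal (Eventually.of_forall hp0), h1]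
  exact ENNReal.one_lt_top

lemma integrable_hell {X : Type*} [MeasurableSpace X] {ν : Measure X} {p q : X → ℝ}
    (hp : Measurable p) (hp0 : ∀ x, 0 ≤ p x) (h1 : ∫⁻ x, ENNReal.ofReal (p x) ∂ν = 1)
    (hq : Measurable q) (hq0 : ∀ x, 0 ≤ q x) (h2 : ∫⁻ x, ENNReal.ofReal (q x) ∂ν = 1) :
    Integrable (fun x => (√(p x) - √(q x)) ^ 2) ν := by
  refine Integrable.mono' (((integrable_dens hp hp0 h1).add (integrable_dens hq hq0 h2)).const_mul 2)
    (by fun_prop) (Eventually.of_forall fun x => ?_)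
  rw [Real.norm_eq_abs, abs_of_nonneg (sq_nonneg _)]
  simp only [Pi.add_apply]
  nlinarith [Real.sq_sqrt (hp0 x), Real.sq_sqrt (hq0 x), sq_nonneg (√(p x) + √(q x))]

lemma second_moment {X : Type*} [MeasurableSpace X] {ν : Measure X} {s p q : X → ℝ}
    (hs : Measurable s) (hs0 : ∀ x, 0 ≤ s x) (h0 : ∫⁻ x, ENNReal.ofReal (s x) ∂ν = 1)
    (hp : Measurable p) (hp0 : ∀ x, 0 ≤ p x) (h1 : ∫⁻ x, ENNReal.ofReal (p x) ∂ν = 1)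
    (hq : Measurable q) (hq0 : ∀ x, 0 ≤ q x) (h2 : ∫⁻ x, ENNReal.ofReal (q x) ∂ν = 1) :
    ∫ x, psiR (p x) (q x) ^ 2 ∂(ν.withDensity fun x => ENNReal.ofReal (s x)) ≤
      2 * hellSq ν s p + 2 * hellSq ν s q := by
  rw [integral_withDensity_eq_integral_toReal_smul (by fun_prop)
    (Eventually.of_forall fun x => ENNReal.ofReal_lt_top)]
  have e : 2 * hellSq ν s p + 2 * hellSq ν s q =
      ∫ x, ((√(s x) - √(p x)) ^ 2 + (√(s x) - √(q x)) ^ 2) ∂ν := by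
    rw [integral_add (integrable_hell hs hs0 h0 hp hp0 h1) (integrable_hell hs hs0 h0 hq hq0 h2)]
    unfold hellSq
    ring
  rw [e]
  refine integral_mono_of_nonneg (Eventually.of_forall fun x => ?_)
    ((integrable_hell hs hs0 h0 hp hp0 h1).add (integrable_hell hs hs0 h0 hq hq0 h2))
    (Eventually.of_forall fun x => ?_)
  · simp only [Pi.zero_apply, smul_eq_mul]
    positivity
  · simp only [smul_eq_mul, ENNReal.toReal_ofReal (hs0 x)]
    exact psiR_sq_le (hs0 x) (hp0 x) (hq0 x)

lemma mgf_one {X : Type*} [MeasurableSpace X] {ν : Measure X} [IsProbabilityMeasure ν]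
    {f : X → ℝ} (hf : Measurable f) (hb : ∀ x, |f x| ≤ 1) {c : ℝ} (hc : |c| ≤ 1) :
    ∫ x, Real.exp (c * f x) ∂ν ≤
      Real.exp (c * ∫ x, f x ∂ν + 3 / 4 * c ^ 2 * ∫ x, f x ^ 2 ∂ν) := by
  have i1 : Integrable f ν :=
    Integrable.of_bound hf.aestronglyMeasurable 1 (Eventually.of_forall hb)
  have i2 : Integrable (fun x => f x ^ 2) ν :=
    Integrable.of_bound (by fun_prop) 1 (Eventually.of_forall fun x => by
      rw [norm_pow]; exact pow_le_one₀ (norm_nonneg _) (hb x))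
  have e : ∫ x, (1 + c * f x + 3 / 4 * c ^ 2 * f x ^ 2) ∂ν =
      1 + (c * ∫ x, f x ∂ν + 3 / 4 * c ^ 2 * ∫ x, f x ^ 2 ∂ν) := by
    have i3 : Integrable (fun x => 1 + c * f x) ν := (integrable_const _).add (i1.const_mul c)
    rw [integral_add i3 (i2.const_mul _),
      integral_add (integrable_const _) (i1.const_mul c), integral_const_mul, integral_const_mul]
    simp; ring
  calc _ ≤ ∫ x, (1 + c * f x + 3 / 4 * c ^ 2 * f x ^ 2) ∂ν := by
        refine integral_mono_of_nonneg (Eventually.of_forall fun x => (Real.exp_pos _).le)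
          (((integrable_const _).add (i1.const_mul c)).add (i2.const_mul _))
          (Eventually.of_forall fun x => ?_)
        have := exp_quad (u := c * f x) (by
          rw [abs_mul]; exact mul_le_one₀ hc (abs_nonneg _) (hb x))
        simp only; rw [mul_pow] at this; linarith
    _ ≤ _ := by
        rw [e, add_comm]; exact Real.add_one_le_exp _

lemma mgf_Psi {n : ℕ} {𝒳 : Fin n → Type*} [∀ i, MeasurableSpace (𝒳 i)]
    (μ : ∀ i, Measure (𝒳 i)) (s t t' : ∀ i, 𝒳 i → ℝ)
    (hs : IsDensityT μ s) (ht : IsDensityT μ t) (ht' : IsDensityT μ t') {y : ℝ} (hy : 0 ≤ y)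
    (h1 : bH μ s t ≤ y) (h2 : bH μ s t' ≤ y) {c : ℝ} (hc : |c| ≤ 1) :
    Integrable (fun x => Real.exp (c * (Psi x t t' - ∫ x', Psi x' t t' ∂(Plaw μ s)))) (Plaw μ s) ∧
    ∫ x, Real.exp (c * (Psi x t t' - ∫ x', Psi x' t t' ∂(Plaw μ s))) ∂(Plaw μ s) ≤
      Real.exp (3 * c ^ 2 * y ^ 2) := by
  have hP : ∀ i, IsProbabilityMeasure ((μ i).withDensity fun x => ENNReal.ofReal (s i x)) := by
    intro i
    constructor
    rw [withDensity_apply _ MeasurableSet.univ, Measure.restrict_univ]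
    exact (hs i).2.2
  have hm : ∀ i, Measurable fun x => psiR (t i x) (t' i x) := fun i =>
    measurable_psiR (ht i).1 (ht' i).1 (ht i).2.1 (ht' i).2.1
  have hb : ∀ i x, |psiR (t i x) (t' i x)| ≤ 1 := fun i x =>
    abs_psiR_le ((ht i).2.1 x) ((ht' i).2.1 x)
  have hmP : Measurable fun x : ∀ i, 𝒳 i => Psi x t t' := by
    unfold Psi
    exact Finset.measurable_sum _ fun i _ => (hm i).comp (measurable_pi_apply i)
  have hbP : ∀ x : ∀ i, 𝒳 i, |Psi x t t'| ≤ n := by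
    intro x
    unfold Psi
    refine (Finset.abs_sum_le_sum_abs _ _).trans ?_
    refine (Finset.sum_le_sum fun i _ => hb i (x i)).trans ?_
    simp
  have hPP : IsProbabilityMeasure (Plaw μ s) := by unfold Plaw; infer_instance
  have hE : ∫ x', Psi x' t t' ∂(Plaw μ s) = ∑ i, ∫ x, psiR (t i x) (t' i x)
      ∂((μ i).withDensity fun x => ENNReal.ofReal (s i x)) := by
    unfold Psi Plaw
    rw [integral_finsetSum]
    · refine Finset.sum_congr rfl fun i _ => ?_
      exact integral_comp_eval (μ := fun i => (μ i).withDensity fun x => ENNReal.ofReal (s i x))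
        (f := fun x => psiR (t i x) (t' i x)) (hm i).aestronglyMeasurable
    · intro i _
      exact Integrable.of_bound ((hm i).comp (measurable_pi_apply i)).aestronglyMeasurable 1
        (Eventually.of_forall fun x => hb i (x i))
  have hM : ∫ x, Real.exp (c * Psi x t t') ∂(Plaw μ s) = ∏ i, ∫ x, Real.exp (c * psiR (t i x) (t' i x))
      ∂((μ i).withDensity fun x => ENNReal.ofReal (s i x)) := by
    unfold Psi Plaw
    rw [← integral_fintype_prod_eq_prod
      (f := fun i x => Real.exp (c * psiR (t i x) (t' i x)))]
    simp_rw [Finset.mul_sum, Real.exp_sum]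
  have hsum : ∀ u : ∀ i, 𝒳 i → ℝ, bH μ s u ≤ y → ∑ i, hellSq (μ i) (s i) (u i) ≤ y ^ 2 := by
    intro u hu
    exact (Real.sqrt_le_left hy).1 hu
  constructor
  · refine Integrable.of_bound (by fun_prop)
      (Real.exp (n + |∫ x', Psi x' t t' ∂(Plaw μ s)|)) (Eventually.of_forall fun x => ?_)
    rw [Real.norm_eq_abs, Real.abs_exp]
    apply Real.exp_le_exp.2
    refine (le_abs_self _).trans ?_
    rw [abs_mul]
    refine (mul_le_of_le_one_left (abs_nonneg _) hc).trans ?_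
    exact (abs_sub _ _).trans (by gcongr; exact hbP x)
  · simp_rw [mul_sub, Real.exp_sub]
    rw [integral_div, div_le_iff₀ (Real.exp_pos _), hM, hE, ← Real.exp_add]
    calc _ ≤ ∏ i, Real.exp (c * ∫ x, psiR (t i x) (t' i x)
              ∂((μ i).withDensity fun x => ENNReal.ofReal (s i x)) + 3 / 4 * c ^ 2 *
              (2 * hellSq (μ i) (s i) (t i) + 2 * hellSq (μ i) (s i) (t' i))) := by
          refine Finset.prod_le_prod (fun i _ => integral_nonneg fun x => (Real.exp_pos _).le)
            fun i _ => (mgf_one (hm i) (hb i) hc).trans ?_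
          apply Real.exp_le_exp.2
          gcongr
          exact second_moment (hs i).1 (hs i).2.1 (hs i).2.2 (ht i).1 (ht i).2.1 (ht i).2.2
            (ht' i).1 (ht' i).2.1 (ht' i).2.2
      _ ≤ _ := by
          rw [← Real.exp_sum]
          apply Real.exp_le_exp.2
          rw [Finset.sum_add_distrib, ← Finset.mul_sum, ← Finset.mul_sum, Finset.sum_add_distrib,
            ← Finset.mul_sum, ← Finset.mul_sum]
          nlinarith [mul_le_mul_of_nonneg_left (hsum t h1) (sq_nonneg c),
            mul_le_mul_of_nonneg_left (hsum t' h2) (sq_nonneg c)]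

lemma wS_le {n : ℕ} {𝒳 : Fin n → Type*} [∀ i, MeasurableSpace (𝒳 i)]
    (μ : ∀ i, Measure (𝒳 i)) (S : Set (∀ i, 𝒳 i → ℝ)) (hS : ∀ t ∈ S, IsDensityT μ t)
    (s : ∀ i, 𝒳 i → ℝ) (hs : IsDensityT μ s) (y : ℝ) (hy : 0 ≤ y) (hy2 : 2000000 ≤ y ^ 2)
    (hfin : {t ∈ S | bH μ s t ≤ y}.Finite)
    (hN : ({t ∈ S | bH μ s t ≤ y}.ncard : ℝ) ≤ Real.exp (y ^ 2 / 1000000)) :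
    wS μ s S y ≤ 6 / 1000 * y ^ 2 := by
  unfold wS
  split_ifs with hne
  swap
  · linarith
  set T := hfin.toFinset with hT
  have hTm : ∀ t, t ∈ T ↔ t ∈ S ∧ bH μ s t ≤ y := by intro t; simp [hT]
  have hTc : (T.card : ℝ) ≤ Real.exp (y ^ 2 / 1000000) := by
    rw [hT, ← Set.ncard_eq_toFinset_card _ hfin]; exact hN
  set E : (∀ i, 𝒳 i → ℝ) × (∀ i, 𝒳 i → ℝ) → ℝ :=
    fun p => ∫ x', Psi x' p.1 p.2 ∂(Plaw μ s) with hEdef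
  set A : ℝ := 55 / 10000000 * y ^ 2 with hA
  set F : (∀ i, 𝒳 i → ℝ) × (∀ i, 𝒳 i → ℝ) → (∀ i, 𝒳 i) → ℝ := fun p x =>
    Real.exp ((1 / 1000) * (Psi x p.1 p.2 - E p)) + Real.exp ((-(1 / 1000)) * (Psi x p.1 p.2 - E p))
    with hF
  have hPP : IsProbabilityMeasure (Plaw μ s) := by
    have hP : ∀ i, IsProbabilityMeasure ((μ i).withDensity fun x => ENNReal.ofReal (s i x)) := by
      intro i
      constructor
      rw [withDensity_apply _ MeasurableSet.univ, Measure.restrict_univ]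
      exact (hs i).2.2
    unfold Plaw; infer_instance
  have hFi : ∀ p ∈ T ×ˢ T, Integrable (F p) (Plaw μ s) ∧
      ∫ x, F p x ∂(Plaw μ s) ≤ 2 * Real.exp (3 / 1000000 * y ^ 2) := by
    intro p hp
    rw [Finset.mem_product, hTm, hTm] at hp
    obtain ⟨⟨a1, a2⟩, b1, b2⟩ := hp
    obtain ⟨i1, j1⟩ := mgf_Psi μ s p.1 p.2 hs (hS _ a1) (hS _ b1) hy a2 b2 (c := 1 / 1000)
      (by rw [abs_le]; norm_num)
    obtain ⟨i2, j2⟩ := mgf_Psi μ s p.1 p.2 hs (hS _ a1) (hS _ b1) hy a2 b2 (c := -(1 / 1000))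
      (by rw [abs_le]; norm_num)
    refine ⟨i1.add i2, ?_⟩
    simp only [hF]
    rw [integral_add i1 i2]
    have e1 : 3 * (1 / 1000 : ℝ) ^ 2 * y ^ 2 = 3 / 1000000 * y ^ 2 := by ring
    have e2 : 3 * (-(1 / 1000) : ℝ) ^ 2 * y ^ 2 = 3 / 1000000 * y ^ 2 := by ring
    rw [e1] at j1
    rw [e2] at j2
    linarith
  set G : (∀ i, 𝒳 i) → ℝ := fun x =>
    1000 * (A - 1 + Real.exp (-A) * ∑ p ∈ T ×ˢ T, F p x) with hG
  have hsumi : Integrable (fun x => ∑ p ∈ T ×ˢ T, F p x) (Plaw μ s) :=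
    integrable_finsetSum _ fun p hp => (hFi p hp).1
  have hGi : Integrable G (Plaw μ s) :=
    ((integrable_const _).add (hsumi.const_mul _)).const_mul _
  have hsum : ∫ x, ∑ p ∈ T ×ˢ T, F p x ∂(Plaw μ s) ≤ Real.exp A := by
    rw [integral_finsetSum _ fun p hp => (hFi p hp).1]
    refine (Finset.sum_le_sum fun p hp => (hFi p hp).2).trans ?_
    rw [Finset.sum_const, Finset.card_product, nsmul_eq_mul, Nat.cast_mul]
    have h2 : (2 : ℝ) ≤ Real.exp (y ^ 2 / 2000000) := by
      have := Real.add_one_le_exp (y ^ 2 / 2000000)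
      have : 1 ≤ y ^ 2 / 2000000 := by rw [le_div_iff₀ (by norm_num)]; linarith
      linarith
    calc _ ≤ Real.exp (y ^ 2 / 1000000) * Real.exp (y ^ 2 / 1000000) *
          (Real.exp (y ^ 2 / 2000000) * Real.exp (3 / 1000000 * y ^ 2)) := by gcongr
      _ = Real.exp A := by
          rw [← Real.exp_add, ← Real.exp_add, ← Real.exp_add, hA]; congr 1; ring
  have hGint : ∫ x, G x ∂(Plaw μ s) ≤ 1000 * A := by
    simp only [hG]
    rw [integral_const_mul, integral_add (integrable_const _) (hsumi.const_mul _),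
      integral_const_mul]
    have : Real.exp (-A) * ∫ x, ∑ p ∈ T ×ˢ T, F p x ∂(Plaw μ s) ≤ 1 := by
      calc _ ≤ Real.exp (-A) * Real.exp A := by gcongr
        _ = 1 := by rw [← Real.exp_add]; simp
    simp
    linarith
  calc _ ≤ ∫ x, G x ∂(Plaw μ s) := by
        refine integral_mono_of_nonneg (Eventually.of_forall fun x => ?_) hGi
          (Eventually.of_forall fun x => ?_)
        · exact Real.iSup_nonneg fun p => abs_nonneg _
        · refine ciSup_le fun p => ?_
          obtain ⟨p, hp1, hp2, hp3, hp4⟩ := p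
          have hpT : p ∈ T ×ˢ T := by
            rw [Finset.mem_product, hTm, hTm]; exact ⟨⟨hp1, hp3⟩, hp2, hp4⟩
          change |Psi x p.1 p.2 - E p| ≤ G x
          have k1 : F p x ≤ ∑ p ∈ T ×ˢ T, F p x :=
            Finset.single_le_sum (f := fun p => F p x)
              (fun q _ => (add_pos (Real.exp_pos _) (Real.exp_pos _)).le) hpT
          have k2 : Real.exp (1 / 1000 * |Psi x p.1 p.2 - E p|) ≤ F p x := by
            simp only [hF]
            rcases abs_cases (Psi x p.1 p.2 - E p) with ⟨h, _⟩ | ⟨h, _⟩ <;> rw [h]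
            · exact le_add_of_nonneg_right (Real.exp_pos _).le
            · rw [mul_neg, ← neg_mul]
              exact le_add_of_nonneg_left (Real.exp_pos _).le
          have k3 := Real.add_one_le_exp (-A + 1 / 1000 * |Psi x p.1 p.2 - E p|)
          rw [Real.exp_add] at k3
          have k4 := mul_le_mul_of_nonneg_left (k2.trans k1) (Real.exp_pos (-A)).le
          simp only [hG]
          linarith
    _ ≤ 1000 * A := hGint
    _ ≤ _ := by rw [hA]; nlinarith

theorem statement_5
    {n : ℕ} {𝒳 : Fin n → Type*} [∀ i, MeasurableSpace (𝒳 i)]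
    (μ : ∀ i, Measure (𝒳 i)) [∀ i, SigmaFinite (μ i)]
    -- S̃ is a totally bounded subset of (𝕃,𝐡) with metric dimension bounded by 𝐃
    (St : Set (∀ i, 𝒳 i → ℝ)) (hSt : ∀ t ∈ St, IsDensityT μ t)
    (htb : ∀ δ : ℝ, 0 < δ → ∃ F : Set (∀ i, 𝒳 i → ℝ), F.Finite ∧
      ∀ t ∈ St, ∃ u ∈ F, bH μ t u ≤ δ)
    (D : ℝ → ℝ) (hdim : DimBoundN μ St D)
    -- ε ≥ 1/2 and 𝐃(ε) ≤ (ε/c₀)², c₀ = 1000 (and 𝐃 takes values in [1/2,∞))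
    (ε : ℝ) (hε : 1 / 2 ≤ ε) (hDε : D ε ≤ (ε / 1000) ^ 2) (hDhalf : 1 / 2 ≤ D ε)
    -- S̄ is an ε-net for S̃ satisfying the metric-dimension cardinality bound
    (Sbar : Set (∀ i, 𝒳 i → ℝ)) (hSbar : ∀ t ∈ Sbar, IsDensityT μ t)
    (hnet : ∀ t ∈ St, ∃ u ∈ Sbar, bH μ t u ≤ ε)
    (hcard : ∀ s : ∀ i, 𝒳 i → ℝ, IsDensityT μ s → ∀ r : ℝ, 2 * ε ≤ r →
      {t ∈ Sbar | bH μ s t ≤ r}.Finite ∧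
      ({t ∈ Sbar | bH μ s t ≤ r}.ncard : ℝ) ≤ Real.exp (D ε * (r / ε) ^ 2)) :
    -- then, with S = S̄, ε^{S̄}(𝐬) ≤ 2ε whatever 𝐬 ∈ 𝕃
    ∀ s : ∀ i, 𝒳 i → ℝ, IsDensityT μ s → epsS μ s Sbar ≤ 2 * ε := by
  intro s hs
  have hε2 : 500000 ≤ ε ^ 2 := by
    have : 1 / 2 ≤ (ε / 1000) ^ 2 := hDhalf.trans hDε
    rw [div_pow, le_div_iff₀ (by norm_num)] at this
    linarith
  have hε0 : 0 < ε := by linarith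
  unfold epsS
  refine Real.sSup_le ?_ (by linarith)
  rintro y ⟨hy1, hy2⟩
  by_contra hlt
  rw [not_le] at hlt
  refine absurd hy2 (not_lt.2 ?_)
  obtain ⟨hf, hN⟩ := hcard s hs y hlt.le
  refine wS_le μ Sbar hSbar s hs y (by linarith) (by nlinarith) hf (hN.trans ?_)
  apply Real.exp_le_exp.2
  calc D ε * (y / ε) ^ 2 ≤ (ε / 1000) ^ 2 * (y / ε) ^ 2 := by gcongr
    _ = y ^ 2 / 1000000 := by field_simp; norm_num

end
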